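/- The function u is differentiable on (0,1) and satisfies the differential equation u'(q) = −(f(-q^5)^5 / f(-q)) · u(q) · √(125 + 22·u(q) + u(q)²) for all 0 < q < 1. In particular u is strictly decreasing on (0,1). -/

import Mathlib

open MeasureTheory Real

/-- Euler's product `f(-q) = ∏_{n=1}^∞ (1 - qⁿ)`. -/
noncomputable def eulerF (q : ℝ) : ℝ := ∏' n : ℕ, (1 - q ^ (n + 1))

/-- `u(q) = f(-q)⁶ / (q · f(-q⁵)⁶)`. -/
noncomputable def uF (q : ℝ) : ℝ := eulerF q ^ 6 / (q * eulerF (q ^ 5) ^ 6)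

/-- The `k`-th moment `∑ (-1)ⁿ (n + 1/2 - α)ᵏ exp (-r (n + 1/2 - α)² / 2)` of the alternating Gaussian
on a shifted lattice; for `k = 0` this is an odd theta function in the characteristic `α`. -/
noncomputable def gaussMoment (k : ℕ) (r α : ℝ) : ℝ :=
  ∑' n : ℤ, (-1 : ℝ) ^ n * (n + 1 / 2 - α) ^ k * exp (-r * (n + 1 / 2 - α) ^ 2 / 2)

/-- A summable majorant of the terms of `gaussMoment k r α` for `|α| ≤ M` and `r ≥ r₀`. -/
noncomputable def gaussBound (k : ℕ) (r₀ M : ℝ) (n : ℤ) : ℝ :=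
  (2 + M) ^ k * (1 + |(n : ℝ)| ^ k) * exp (-r₀ / 2 * (n ^ 2 - 2 * (M + 1) * |(n : ℝ)|))

lemma abs_neg_one_zpow_mul (n : ℤ) (x : ℝ) : |(-1 : ℝ) ^ n * x| = |x| := by
  rw [abs_mul, abs_zpow, abs_neg, abs_one, one_zpow, one_mul]

lemma summable_gaussBound (k : ℕ) {r₀ : ℝ} (h : 0 < r₀) (M : ℝ) : Summable (gaussBound k r₀ M) := by
  have key (j : ℕ) := summable_pow_mul_jacobiTheta₂_term_bound ((M + 1) * r₀ / (2 * π))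
    (T := r₀ / (2 * π)) (by positivity) j
  refine (((key 0).add (key k)).mul_left ((2 + M) ^ k)).congr fun n ↦ ?_
  have : -π * (r₀ / (2 * π) * (n : ℝ) ^ 2 - 2 * ((M + 1) * r₀ / (2 * π)) * |(n : ℝ)|) =
      -r₀ / 2 * (n ^ 2 - 2 * (M + 1) * |(n : ℝ)|) := by
    field_simp
  simp only [this, gaussBound, Int.cast_abs]
  ring

lemma abs_gaussMoment_term_le (k : ℕ) {r₀ M r α : ℝ} (h₀ : 0 < r₀) (hr : r₀ ≤ r) (hα : |α| ≤ M) (n : ℤ) :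
    |(-1 : ℝ) ^ n * (n + 1 / 2 - α) ^ k * exp (-r * (n + 1 / 2 - α) ^ 2 / 2)| ≤
      gaussBound k r₀ M n := by
  have hM : 0 ≤ M := (abs_nonneg α).trans hα
  have hα' := abs_le.1 hα
  rw [mul_assoc, abs_neg_one_zpow_mul, abs_mul, abs_pow, abs_exp, gaussBound]
  gcongr ?_ * exp ?_
  · have h1 : |(n : ℝ) + 1 / 2 - α| ≤ (2 + M) * max 1 |(n : ℝ)| := by
      have h2 : |(n : ℝ) + 1 / 2 - α| ≤ |(n : ℝ)| + (1 / 2 + M) := by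
        rw [abs_le]
        constructor <;> linarith [neg_abs_le (n : ℝ), le_abs_self (n : ℝ)]
      nlinarith [le_max_left 1 |(n : ℝ)|, le_max_right 1 |(n : ℝ)|]
    calc |(n : ℝ) + 1 / 2 - α| ^ k ≤ ((2 + M) * max 1 |(n : ℝ)|) ^ k := by gcongr
      _ = (2 + M) ^ k * max 1 |(n : ℝ)| ^ k := mul_pow _ _ _
      _ ≤ _ := by
        gcongr
        rcases max_cases 1 |(n : ℝ)| with ⟨h, -⟩ | ⟨h, -⟩ <;> rw [h]
        · simp
        · linarith
  · have h1 : (n : ℝ) ^ 2 - 2 * (M + 1) * |(n : ℝ)| ≤ (n + 1 / 2 - α) ^ 2 := by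
      have : -(|(n : ℝ)| * (1 / 2 + M)) ≤ n * (1 / 2 - α) := by
        have := neg_abs_le ((n : ℝ) * (1 / 2 - α))
        rw [abs_mul] at this
        have h3 : |1 / 2 - α| ≤ 1 / 2 + M := by
          rw [abs_le]; constructor <;> linarith
        nlinarith [mul_le_mul_of_nonneg_left h3 (abs_nonneg (n : ℝ))]
      nlinarith [abs_nonneg (n : ℝ), sq_nonneg (1 / 2 - α)]
    nlinarith [sq_nonneg ((n : ℝ) + 1 / 2 - α)]

lemma summable_gaussMoment (k : ℕ) {r : ℝ} (hr : 0 < r) (α : ℝ) :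
    Summable fun n : ℤ ↦ (-1 : ℝ) ^ n * (n + 1 / 2 - α) ^ k * exp (-r * (n + 1 / 2 - α) ^ 2 / 2) :=
  .of_norm_bounded (summable_gaussBound k hr |α|)
    fun n ↦ abs_gaussMoment_term_le k hr le_rfl le_rfl n

lemma hasDerivAt_gaussMoment (k : ℕ) {r : ℝ} (hr : 0 < r) (α : ℝ) :
    HasDerivAt (gaussMoment k r) (r * gaussMoment (k + 1) r α - k * gaussMoment (k - 1) r α) α := by
  have hu := ((summable_gaussBound (k + 1) hr (|α| + 1)).mul_left r).add
    ((summable_gaussBound (k - 1) hr (|α| + 1)).mul_left (k : ℝ))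
  have hα : α ∈ Metric.ball α 1 := Metric.mem_ball_self one_pos
  have := hasDerivAt_tsum_of_isPreconnected hu Metric.isOpen_ball
    (convex_ball α 1).isPreconnected
    (g := fun (n : ℤ) α ↦ (-1 : ℝ) ^ n * (n + 1 / 2 - α) ^ k * exp (-r * (n + 1 / 2 - α) ^ 2 / 2))
    (g' := fun (n : ℤ) α ↦
      r * ((-1 : ℝ) ^ n * (n + 1 / 2 - α) ^ (k + 1) * exp (-r * (n + 1 / 2 - α) ^ 2 / 2)) -
      k * ((-1 : ℝ) ^ n * (n + 1 / 2 - α) ^ (k - 1) * exp (-r * (n + 1 / 2 - α) ^ 2 / 2)))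
    (fun n y _ ↦ ?_) (fun n y hy ↦ ?_) hα (summable_gaussMoment k hr α) hα
  · rw [((summable_gaussMoment (k + 1) hr α).mul_left r).tsum_sub
      ((summable_gaussMoment (k - 1) hr α).mul_left (k : ℝ)), tsum_mul_left, tsum_mul_left] at this
    exact this
  · have h1 : HasDerivAt (fun y : ℝ ↦ (n : ℝ) + 1 / 2 - y) (-1) y := by
      simpa using (hasDerivAt_id y).const_sub ((n : ℝ) + 1 / 2)
    have h2 := ((h1.pow 2).const_mul (-r)).div_const 2
    refine (((h1.pow k).const_mul ((-1 : ℝ) ^ n)).mul h2.exp).congr_deriv ?_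
    simp only [Pi.pow_apply]
    ring
  · have hy' : |y| ≤ |α| + 1 := by
      have := abs_sub_abs_le_abs_sub y α
      rw [Metric.mem_ball, dist_eq] at hy
      linarith
    refine (abs_sub _ _).trans (add_le_add ?_ ?_)
    · rw [abs_mul, abs_of_pos hr]
      gcongr
      exact abs_gaussMoment_term_le _ hr le_rfl hy' n
    · rw [abs_mul, Nat.abs_cast]
      gcongr
      exact abs_gaussMoment_term_le _ hr le_rfl hy' n

lemma hasDerivAt_gaussMoment_rate (k : ℕ) {r : ℝ} (hr : 0 < r) (α : ℝ) :
    HasDerivAt (fun r ↦ gaussMoment k r α) (-gaussMoment (k + 2) r α / 2) r := by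
  have hr2 : 0 < r / 2 := by positivity
  have hu := (summable_gaussBound (k + 2) hr2 |α|).mul_left (1 / 2)
  have hmem : r ∈ Set.Ioi (r / 2) := half_lt_self hr
  have := hasDerivAt_tsum_of_isPreconnected hu isOpen_Ioi isPreconnected_Ioi
    (g := fun (n : ℤ) r ↦ (-1 : ℝ) ^ n * (n + 1 / 2 - α) ^ k * exp (-r * (n + 1 / 2 - α) ^ 2 / 2))
    (g' := fun (n : ℤ) r ↦
      -1 / 2 * ((-1 : ℝ) ^ n * (n + 1 / 2 - α) ^ (k + 2) * exp (-r * (n + 1 / 2 - α) ^ 2 / 2)))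
    (fun n y _ ↦ ?_) (fun n y hy ↦ ?_) hmem (summable_gaussMoment k hr α) hmem
  · rw [tsum_mul_left] at this
    exact this.congr_deriv (by rw [gaussMoment]; ring)
  · have h1 := (((hasDerivAt_id y).neg.mul_const (((n : ℝ) + 1 / 2 - α) ^ 2)).div_const 2).exp
    refine (h1.const_mul ((-1 : ℝ) ^ n * (n + 1 / 2 - α) ^ k)).congr_deriv ?_
    simp only [Pi.neg_apply, id]
    ring
  · rw [norm_mul, show ‖(-1 / 2 : ℝ)‖ = 1 / 2 by norm_num]
    gcongr
    exact abs_gaussMoment_term_le _ hr2 (le_of_lt hy) le_rfl n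

lemma gaussMoment_neg (k : ℕ) (r α : ℝ) :
    gaussMoment k r (-α) = -(-1) ^ k * gaussMoment k r α := by
  rw [gaussMoment, gaussMoment, ← tsum_mul_left, ← (Equiv.subLeft (-1 : ℤ)).tsum_eq]
  refine tsum_congr fun n ↦ ?_
  have h1 : (((-1 - n : ℤ) : ℝ)) + 1 / 2 - -α = -1 * (n + 1 / 2 - α) := by push_cast; ring
  rw [Equiv.subLeft_apply, h1, mul_pow, zpow_sub₀ (by norm_num), mul_pow]
  have : (-1 : ℝ) ^ n * (-1 : ℝ) ^ n = 1 := by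
    rw [← mul_zpow]; norm_num
  have h3 : ((-1 : ℝ) ^ n)⁻¹ = (-1) ^ n := by
    rw [← inv_zpow]; norm_num
  rw [div_eq_mul_inv, h3]
  norm_num
  ring

lemma gaussMoment_add_one (k : ℕ) (r α : ℝ) : gaussMoment k r (α + 1) = -gaussMoment k r α := by
  rw [gaussMoment, gaussMoment, ← tsum_neg, ← (Equiv.addRight (1 : ℤ)).tsum_eq]
  refine tsum_congr fun n ↦ ?_
  have h1 : (((n + 1 : ℤ) : ℝ)) + 1 / 2 - (α + 1) = n + 1 / 2 - α := by push_cast; ring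
  rw [Equiv.coe_addRight, h1, zpow_add₀ (by norm_num)]
  ring

/-- The equivalence sorting pairs of integers by the parity of their sum. -/
def sumDiffEquiv : (ℤ × ℤ) ⊕ (ℤ × ℤ) ≃ ℤ × ℤ where
  toFun
    | .inl (a, b) => (a + b, a - b)
    | .inr (a, b) => (a + b, a - b - 1)
  invFun x := if (x.1 + x.2) % 2 = 0 then .inl ((x.1 + x.2) / 2, (x.1 - x.2) / 2)
    else .inr ((x.1 + x.2 + 1) / 2, (x.1 - x.2 - 1) / 2)
  left_inv := by
    rintro (⟨a, b⟩ | ⟨a, b⟩)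
    · have : (a + b + (a - b)) % 2 = 0 := by omega
      simp only [this, if_true, Sum.inl.injEq, Prod.mk.injEq]
      omega
    · have : ¬ (a + b + (a - b - 1)) % 2 = 0 := by omega
      simp only [this, if_false, Sum.inr.injEq, Prod.mk.injEq]
      omega
  right_inv := by
    rintro ⟨m, n⟩
    by_cases h : (m + n) % 2 = 0
    · simp only [h, if_true, Prod.mk.injEq]
      omega
    · simp only [h, if_false, Prod.mk.injEq]
      omega

/-- The theta function `∑ exp (-r (n + c)²)`. -/
noncomputable def gaussTheta (r c : ℝ) : ℝ := ∑' n : ℤ, exp (-r * (n + c) ^ 2)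

lemma summable_gaussTheta {r : ℝ} (hr : 0 < r) (c : ℝ) :
    Summable fun n : ℤ ↦ exp (-r * (n + c) ^ 2) := by
  refine (summable_gaussMoment 0 (mul_pos two_pos hr) (1 / 2 - c)).abs.congr fun n ↦ ?_
  rw [mul_assoc, abs_neg_one_zpow_mul, pow_zero, one_mul, abs_exp]
  congr 1
  ring

lemma gaussMoment_zero_mul {r : ℝ} (hr : 0 < r) (x y : ℝ) :
    gaussMoment 0 r (x + y) * gaussMoment 0 r (x - y) =
      gaussTheta r (1 / 2 - x) * gaussTheta r (-y) - gaussTheta r (-x) * gaussTheta r (1 / 2 - y) := by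
  have hs (c d : ℝ) : Summable fun p : ℤ × ℤ ↦ exp (-r * (p.1 + c) ^ 2) * exp (-r * (p.2 + d) ^ 2) :=
    (summable_gaussTheta hr c).mul_of_nonneg (summable_gaussTheta hr d)
      (fun _ ↦ (exp_pos _).le) (fun _ ↦ (exp_pos _).le)
  have e (c d : ℝ) := (summable_gaussTheta hr c).tsum_mul_tsum (summable_gaussTheta hr d) (hs c d)
  have h1 := (summable_gaussMoment 0 hr (x + y))
  have h2 := (summable_gaussMoment 0 hr (x - y))
  have hl (a b : ℤ) : (-1 : ℝ) ^ (a + b) * (((a + b : ℤ) : ℝ) + 1 / 2 - (x + y)) ^ 0 *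
      exp (-r * (((a + b : ℤ) : ℝ) + 1 / 2 - (x + y)) ^ 2 / 2) *
      ((-1 : ℝ) ^ (a - b) * (((a - b : ℤ) : ℝ) + 1 / 2 - (x - y)) ^ 0 *
      exp (-r * (((a - b : ℤ) : ℝ) + 1 / 2 - (x - y)) ^ 2 / 2)) =
      exp (-r * (a + (1 / 2 - x)) ^ 2) * exp (-r * (b + (-y)) ^ 2) := by
    have : (-1 : ℝ) ^ (a + b) * (-1) ^ (a - b) = 1 := by
      rw [← zpow_add₀ (by norm_num), show a + b + (a - b) = 2 * a by ring, zpow_mul]; norm_num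
    rw [← exp_add, pow_zero, pow_zero, mul_one, mul_one, mul_mul_mul_comm, this, ← exp_add, one_mul]
    congr 1
    push_cast
    ring
  have hr' (a b : ℤ) : (-1 : ℝ) ^ (a + b) * (((a + b : ℤ) : ℝ) + 1 / 2 - (x + y)) ^ 0 *
      exp (-r * (((a + b : ℤ) : ℝ) + 1 / 2 - (x + y)) ^ 2 / 2) *
      ((-1 : ℝ) ^ (a - b - 1) * (((a - b - 1 : ℤ) : ℝ) + 1 / 2 - (x - y)) ^ 0 *
      exp (-r * (((a - b - 1 : ℤ) : ℝ) + 1 / 2 - (x - y)) ^ 2 / 2)) =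
      -(exp (-r * (a + (-x)) ^ 2) * exp (-r * (b + (1 / 2 - y)) ^ 2)) := by
    have : (-1 : ℝ) ^ (a + b) * (-1) ^ (a - b - 1) = -1 := by
      rw [← zpow_add₀ (by norm_num), show a + b + (a - b - 1) = 2 * a - 1 by ring,
        zpow_sub₀ (by norm_num), zpow_mul]
      norm_num
    rw [← exp_add, pow_zero, pow_zero, mul_one, mul_one, mul_mul_mul_comm, this, ← exp_add,
      neg_one_mul]
    congr 2
    push_cast
    ring
  have hinl := (hs (1 / 2 - x) (-y)).hasSum
  have hinr := (hs (-x) (1 / 2 - y)).hasSum.neg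
  rw [← e] at hinl hinr
  have hprod := summable_mul_of_summable_norm h1.norm h2.norm
  rw [gaussMoment, gaussMoment, h1.tsum_mul_tsum h2 hprod, gaussTheta, gaussTheta, gaussTheta, gaussTheta,
    sub_eq_add_neg]
  refine (sumDiffEquiv.hasSum_iff.1 (HasSum.sum ?_ ?_)).tsum_eq
  · simp only [← hl] at hinl
    exact hinl
  · simp only [← hr'] at hinr
    exact hinr

lemma gaussMoment_zero_four_term {r : ℝ} (hr : 0 < r) (x y z w : ℝ) :
    gaussMoment 0 r (x + y) * gaussMoment 0 r (x - y) *
        (gaussMoment 0 r (z + w) * gaussMoment 0 r (z - w)) -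
      gaussMoment 0 r (x + z) * gaussMoment 0 r (x - z) *
        (gaussMoment 0 r (y + w) * gaussMoment 0 r (y - w)) +
      gaussMoment 0 r (x + w) * gaussMoment 0 r (x - w) *
        (gaussMoment 0 r (y + z) * gaussMoment 0 r (y - z)) = 0 := by
  simp only [gaussMoment_zero_mul hr]
  ring

lemma gaussMoment_zero_neg (r α : ℝ) : gaussMoment 0 r (-α) = -gaussMoment 0 r α := by
  simp [gaussMoment_neg]

lemma gaussMoment_zero_zero (r : ℝ) : gaussMoment 0 r 0 = 0 := by
  have := gaussMoment_zero_neg r 0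
  rw [neg_zero] at this
  linarith

lemma gaussMoment_two_zero (r : ℝ) : gaussMoment 2 r 0 = 0 := by
  have := gaussMoment_neg 2 r 0
  rw [neg_zero] at this
  linarith

lemma gaussMoment_triplication {r : ℝ} (hr : 0 < r) (x s : ℝ) :
    gaussMoment 0 r (3 * x) * gaussMoment 0 r x * gaussMoment 0 r (x + s) ^ 2 =
      gaussMoment 0 r x ^ 2 * (gaussMoment 0 r (3 * x + s) * gaussMoment 0 r (x - s)) +
      gaussMoment 0 r (2 * x + s) * gaussMoment 0 r s * gaussMoment 0 r (2 * x) ^ 2 := by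
  have := gaussMoment_zero_four_term hr x (2 * x) 0 (x + s)
  rw [show x + 2 * x = 3 * x by ring, show x - 2 * x = -x by ring, zero_add, zero_sub, add_zero,
    sub_zero, show 2 * x + (x + s) = 3 * x + s by ring, show 2 * x - (x + s) = x - s by ring,
    show x + (x + s) = 2 * x + s by ring, show x - (x + s) = -s by ring, add_zero, sub_zero,
    gaussMoment_zero_neg, gaussMoment_zero_neg, gaussMoment_zero_neg] at this
  linear_combination this

lemma gaussMoment_duplication {r : ℝ} (hr : 0 < r) (x s : ℝ) :
    gaussMoment 0 r (2 * x) * gaussMoment 0 r x ^ 2 * gaussMoment 0 r (2 * s) =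
      gaussMoment 0 r s * (gaussMoment 0 r (2 * x + s) * gaussMoment 0 r (x - s) ^ 2 +
        gaussMoment 0 r (2 * x - s) * gaussMoment 0 r (x + s) ^ 2) := by
  have := gaussMoment_zero_four_term hr x (x + s) (x - s) 0
  rw [show x + (x + s) = 2 * x + s by ring, show x - (x + s) = -s by ring,
    show x + (x - s) = 2 * x - s by ring, show x - (x - s) = s by ring,
    show x + s + (x - s) = 2 * x by ring, show x + s - (x - s) = 2 * s by ring,
    gaussMoment_zero_neg] at this
  simp only [add_zero, sub_zero] at this
  linear_combination this

lemma gaussMoment_triplication_deriv {r : ℝ} (hr : 0 < r) (x : ℝ) :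
    3 * gaussMoment 0 r (3 * x) * gaussMoment 0 r x ^ 2 * gaussMoment 1 r x =
      gaussMoment 0 r x ^ 3 * gaussMoment 1 r (3 * x) +
        gaussMoment 1 r 0 * gaussMoment 0 r (2 * x) ^ 3 := by
  have d (c : ℝ) : HasDerivAt (fun s ↦ gaussMoment 0 r (c + s)) (r * gaussMoment 1 r c) 0 := by
    have := (hasDerivAt_gaussMoment 0 hr (c + 0)).comp_const_add c 0
    simpa using this
  have d' : HasDerivAt (fun s ↦ gaussMoment 0 r (x - s)) (-(r * gaussMoment 1 r x)) 0 := by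
    have := (hasDerivAt_gaussMoment 0 hr (x - 0)).comp_const_sub x 0
    simpa using this
  have d0 : HasDerivAt (fun s ↦ gaussMoment 0 r s) (r * gaussMoment 1 r 0) 0 := by
    simpa using d 0
  have h1 := ((d x).pow 2).const_mul (gaussMoment 0 r (3 * x) * gaussMoment 0 r x)
  have h2 := (((d (3 * x)).mul d').const_mul (gaussMoment 0 r x ^ 2)).add
    (((d (2 * x)).mul d0).mul_const (gaussMoment 0 r (2 * x) ^ 2))
  have := h1.unique (h2.congr_of_eventuallyEq
    (.of_forall fun s ↦ gaussMoment_triplication hr x s))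
  simp only [add_zero, sub_zero, gaussMoment_zero_zero] at this
  apply mul_left_cancel₀ hr.ne'
  linear_combination this

/-- The third-order term at the origin of a duplication formula for an odd function `φ`. -/
lemma third_deriv_of_duplication {φ φ₁ φ₂ : ℝ → ℝ} {φ₃ x : ℝ} (h : ∀ s, HasDerivAt φ (φ₁ s) s)
    (h₁ : ∀ s, HasDerivAt φ₁ (φ₂ s) s) (h₂ : Differentiable ℝ φ₂) (h₃ : HasDerivAt φ₂ φ₃ 0)
    (h0 : φ 0 = 0) (h20 : φ₂ 0 = 0)
    (hdup : ∀ s, φ (2 * x) * φ x ^ 2 * φ (2 * s) =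
      φ s * (φ (2 * x + s) * φ (x - s) ^ 2 + φ (2 * x - s) * φ (x + s) ^ 2)) :
    φ₃ * (φ (2 * x) * φ x ^ 2) = φ₁ 0 * (φ₂ (2 * x) * φ x ^ 2 - 4 * φ₁ (2 * x) * φ x * φ₁ x +
      2 * φ (2 * x) * (φ₁ x ^ 2 + φ x * φ₂ x)) := by
  have plus {f g : ℝ → ℝ} (hf : ∀ s, HasDerivAt f (g s) s) (c s : ℝ) :
      HasDerivAt (fun s ↦ f (c + s)) (g (c + s)) s := (hf (c + s)).comp_const_add c s
  have minus {f g : ℝ → ℝ} (hf : ∀ s, HasDerivAt f (g s) s) (c s : ℝ) :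
      HasDerivAt (fun s ↦ f (c - s)) (-g (c - s)) s := (hf (c - s)).comp_const_sub c s
  have twice {f : ℝ → ℝ} {g s : ℝ} (hf : HasDerivAt f g (2 * s)) :
      HasDerivAt (fun s ↦ f (2 * s)) (g * 2) s :=
    hf.comp s (by simpa using (hasDerivAt_id s).const_mul 2)
  obtain ⟨M₁, hM₁⟩ : ∃ M₁ : ℝ → ℝ, M₁ = fun s ↦
    (φ₁ (2 * x + s) * φ (x - s) ^ 2 - 2 * φ (2 * x + s) * φ (x - s) * φ₁ (x - s)) -
    (φ₁ (2 * x - s) * φ (x + s) ^ 2 - 2 * φ (2 * x - s) * φ (x + s) * φ₁ (x + s)) := ⟨_, rfl⟩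
  obtain ⟨M₂, hM₂⟩ : ∃ M₂ : ℝ → ℝ, M₂ = fun s ↦
    (φ₂ (2 * x + s) * φ (x - s) ^ 2 - 4 * φ₁ (2 * x + s) * φ (x - s) * φ₁ (x - s) +
      2 * φ (2 * x + s) * (φ₁ (x - s) ^ 2 + φ (x - s) * φ₂ (x - s))) +
    (φ₂ (2 * x - s) * φ (x + s) ^ 2 - 4 * φ₁ (2 * x - s) * φ (x + s) * φ₁ (x + s) +
      2 * φ (2 * x - s) * (φ₁ (x + s) ^ 2 + φ (x + s) * φ₂ (x + s))) := ⟨_, rfl⟩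
  have dM (s : ℝ) : HasDerivAt (fun s ↦ φ (2 * x + s) * φ (x - s) ^ 2 +
      φ (2 * x - s) * φ (x + s) ^ 2) (M₁ s) s := by
    refine (((plus h _ s).mul ((minus h _ s).pow 2)).add
      ((minus h _ s).mul ((plus h _ s).pow 2))).congr_deriv ?_
    simp only [hM₁, Pi.pow_apply]
    ring
  have dM₁ (s : ℝ) : HasDerivAt M₁ (M₂ s) s := by
    rw [hM₁]
    refine ((((plus h₁ _ s).mul ((minus h _ s).pow 2)).sub
      ((((plus h _ s).const_mul 2).mul (minus h _ s)).mul (minus h₁ _ s))).sub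
      (((minus h₁ _ s).mul ((plus h _ s).pow 2)).sub
      ((((minus h _ s).const_mul 2).mul (plus h _ s)).mul (plus h₁ _ s)))).congr_deriv ?_
    simp only [hM₂, Pi.pow_apply, Pi.mul_apply]
    ring
  have dM₂ : DifferentiableAt ℝ M₂ 0 := by
    have e : Differentiable ℝ φ := fun s ↦ (h s).differentiableAt
    have e₁ : Differentiable ℝ φ₁ := fun s ↦ (h₁ s).differentiableAt
    rw [hM₂]
    fun_prop
  have i₁ (s : ℝ) := ((twice (h (2 * s))).const_mul (φ (2 * x) * φ x ^ 2)).unique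
    (((h s).mul (dM s)).congr_of_eventuallyEq (.of_forall hdup))
  have i₂ (s : ℝ) := (((twice (h₁ (2 * s))).mul_const 2).const_mul (φ (2 * x) * φ x ^ 2)).unique
    ((((h₁ s).mul (dM s)).add ((h s).mul (dM₁ s))).congr_of_eventuallyEq (.of_forall i₁))
  have h₃' : HasDerivAt φ₂ φ₃ (2 * 0) := by rwa [mul_zero]
  have i₃ := ((((twice h₃').mul_const 2).mul_const 2).const_mul (φ (2 * x) * φ x ^ 2)).unique
    ((((h₃.mul (dM 0)).add ((h₁ 0).mul (dM₁ 0))).add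
      (((h₁ 0).mul (dM₁ 0)).add ((h 0).mul dM₂.hasDerivAt))).congr_of_eventuallyEq
        (.of_forall i₂))
  simp only [h0, h20, hM₁, hM₂, add_zero, sub_zero] at i₃
  linear_combination i₃ / 6

lemma gaussMoment_duplication_deriv {r : ℝ} (hr : 0 < r) (x : ℝ) :
    (r ^ 2 * gaussMoment 3 r 0 - 3 * r * gaussMoment 1 r 0) *
        (gaussMoment 0 r (2 * x) * gaussMoment 0 r x ^ 2) =
      gaussMoment 1 r 0 * (
        (r ^ 2 * gaussMoment 2 r (2 * x) - r * gaussMoment 0 r (2 * x)) * gaussMoment 0 r x ^ 2 -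
        4 * r ^ 2 * gaussMoment 1 r (2 * x) * gaussMoment 0 r x * gaussMoment 1 r x +
        2 * gaussMoment 0 r (2 * x) * (r ^ 2 * gaussMoment 1 r x ^ 2 +
          gaussMoment 0 r x * (r ^ 2 * gaussMoment 2 r x - r * gaussMoment 0 r x))) := by
  have h (s : ℝ) : HasDerivAt (gaussMoment 0 r) (r * gaussMoment 1 r s) s := by
    simpa using hasDerivAt_gaussMoment 0 hr s
  have h₁ (s : ℝ) : HasDerivAt (fun s ↦ r * gaussMoment 1 r s)
      (r ^ 2 * gaussMoment 2 r s - r * gaussMoment 0 r s) s := by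
    refine ((hasDerivAt_gaussMoment 1 hr s).const_mul r).congr_deriv ?_
    simp
    ring
  have h₂ (s : ℝ) : HasDerivAt (fun s ↦ r ^ 2 * gaussMoment 2 r s - r * gaussMoment 0 r s)
      (r * (r ^ 2 * gaussMoment 3 r s - 3 * r * gaussMoment 1 r s)) s := by
    refine (((hasDerivAt_gaussMoment 2 hr s).const_mul (r ^ 2)).sub
      ((h s).const_mul r)).congr_deriv ?_
    simp
    ring
  have := third_deriv_of_duplication h h₁ (fun s ↦ (h₂ s).differentiableAt) (h₂ 0)
    (gaussMoment_zero_zero r) (by rw [gaussMoment_two_zero, gaussMoment_zero_zero]; ring)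
    (gaussMoment_duplication hr x)
  apply mul_left_cancel₀ hr.ne'
  linear_combination this

/-- The Gaussian binomial coefficient, by its Pascal recursion. -/
def gaussBinom (p : ℝ) : ℕ → ℕ → ℝ
  | _, 0 => 1
  | 0, _ + 1 => 0
  | M + 1, j + 1 => gaussBinom p M (j + 1) + p ^ (M - j) * gaussBinom p M j

lemma gaussBinom_zero_right (p : ℝ) (M : ℕ) : gaussBinom p M 0 = 1 := by
  cases M <;> rfl

lemma gaussBinom_succ_succ (p : ℝ) (M j : ℕ) : gaussBinom p (M + 1) (j + 1) =
    gaussBinom p M (j + 1) + p ^ (M - j) * gaussBinom p M j := rfl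

lemma gaussBinom_eq_zero (p : ℝ) {M j : ℕ} (h : M < j) : gaussBinom p M j = 0 := by
  induction M generalizing j with
  | zero => obtain ⟨j, rfl⟩ := Nat.exists_eq_succ_of_ne_zero h.ne'; rfl
  | succ M ih =>
    obtain ⟨j, rfl⟩ := Nat.exists_eq_succ_of_ne_zero (Nat.ne_zero_of_lt h)
    rw [Nat.succ_eq_add_one, gaussBinom_succ_succ, ih (by omega), ih (by omega), mul_zero, add_zero]

lemma prod_one_add_mul_pow (p y : ℝ) (M : ℕ) : ∏ k ∈ Finset.range M, (1 + y * p ^ k) =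
    ∑ j ∈ Finset.range (M + 1), p ^ (j.choose 2) * gaussBinom p M j * y ^ j := by
  induction M with
  | zero => simp [gaussBinom_zero_right]
  | succ M ih =>
    have h0 : ∑ j ∈ Finset.range (M + 1), p ^ (j.choose 2) * gaussBinom p M j * y ^ j =
        ∑ j ∈ Finset.range (M + 1), p ^ ((j + 1).choose 2) * gaussBinom p M (j + 1) * y ^ (j + 1) +
          1 := by
      have := Finset.sum_range_succ' (fun j ↦ p ^ (j.choose 2) * gaussBinom p M j * y ^ j) (M + 1)
      rw [Finset.sum_range_succ, gaussBinom_eq_zero p M.lt_succ_self] at this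
      simpa [gaussBinom_zero_right] using this
    rw [Finset.prod_range_succ, ih, Finset.sum_range_succ' _ (M + 1), mul_add, mul_one]
    nth_rewrite 1 [h0]
    rw [Finset.sum_mul, add_right_comm, ← Finset.sum_add_distrib]
    congr 1
    · refine Finset.sum_congr rfl fun j hj ↦ ?_
      have hj' : j ≤ M := Finset.mem_range_succ_iff.1 hj
      have : p ^ M = p ^ j * p ^ (M - j) := by rw [← pow_add, Nat.add_sub_cancel' hj']
      rw [gaussBinom_succ_succ, this, Nat.choose_succ_succ' j 1, Nat.choose_one_right, pow_add]
      ring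
    · simp [gaussBinom_zero_right]

lemma gaussBinom_mul_prod_mul_prod (p : ℝ) (a b : ℕ) : gaussBinom p (a + b) a *
      ((∏ k ∈ Finset.range a, (1 - p ^ (k + 1))) * ∏ k ∈ Finset.range b, (1 - p ^ (k + 1))) =
    ∏ k ∈ Finset.range (a + b), (1 - p ^ (k + 1)) := by
  induction h : a + b generalizing a b with
  | zero =>
    obtain ⟨rfl, rfl⟩ := Nat.add_eq_zero_iff.1 h
    simp [gaussBinom_zero_right]
  | succ M ih =>
    rcases a with _ | a
    · obtain rfl : b = M + 1 := by omega
      simp [gaussBinom_zero_right]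
    have i1 := ih a b (by omega)
    rcases b with _ | b
    · obtain rfl : a = M := by omega
      rw [gaussBinom_succ_succ, gaussBinom_eq_zero p a.lt_succ_self, Nat.sub_self,
        Finset.prod_range_succ]
      simp only [Finset.range_zero, Finset.prod_empty] at i1 ⊢
      linear_combination (1 - p ^ (a + 1)) * i1
    have i2 := ih (a + 1) b (by omega)
    obtain rfl : M = a + b + 1 := by omega
    rw [gaussBinom_succ_succ, show a + b + 1 - a = b + 1 by omega]
    simp only [Finset.prod_range_succ] at i1 i2 ⊢
    rw [show a + b + 1 + 1 = (a + 1) + (b + 1) by ring, pow_add _ (a + 1)]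
    linear_combination (1 - p ^ (b + 1)) * i2 + p ^ (b + 1) * (1 - p ^ (a + 1)) * i1

lemma summable_pow_succ {p : ℝ} (h0 : 0 ≤ p) (h1 : p < 1) : Summable fun k : ℕ ↦ p ^ (k + 1) :=
  (summable_nat_add_iff 1).2 (summable_geometric_of_lt_one h0 h1)

lemma multipliable_one_sub {f : ℕ → ℝ} (hf : Summable f) : Multipliable fun k ↦ 1 - f k := by
  simpa only [sub_eq_add_neg] using Real.multipliable_one_add_of_summable hf.neg

lemma tprod_one_sub_pos {f : ℕ → ℝ} (hf : Summable f) (h1 : ∀ k, f k < 1) :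
    0 < ∏' k, (1 - f k) := by
  have hnonneg : 0 ≤ ∏' k, (1 - f k) :=
    ge_of_tendsto' (multipliable_one_sub hf).hasProd.tendsto_prod_nat
      fun n ↦ Finset.prod_nonneg fun k _ ↦ by linarith [h1 k]
  have hne : ∏' k, (1 + -f k) ≠ 0 :=
    tprod_one_add_ne_zero_of_summable (fun k ↦ by linarith [h1 k]) hf.neg.norm
  simp only [← sub_eq_add_neg] at hne
  exact lt_of_le_of_ne hnonneg hne.symm

lemma eulerF_pos {q : ℝ} (h0 : 0 < q) (h1 : q < 1) : 0 < eulerF q :=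
  tprod_one_sub_pos (summable_pow_succ h0.le h1) fun _ ↦ pow_lt_one₀ h0.le h1 (by simp)

lemma eulerF_le_prod_range {q : ℝ} (h0 : 0 < q) (h1 : q < 1) (n : ℕ) :
    eulerF q ≤ ∏ k ∈ Finset.range n, (1 - q ^ (k + 1)) := by
  have anti : Antitone fun n ↦ ∏ k ∈ Finset.range n, (1 - q ^ (k + 1)) := by
    refine antitone_nat_of_succ_le fun n ↦ ?_
    rw [Finset.prod_range_succ]
    refine mul_le_of_le_one_right (Finset.prod_nonneg fun k _ ↦ ?_) ?_
    · linarith [pow_le_one₀ h0.le h1.le (n := k + 1)]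
    · linarith [pow_pos h0 (n + 1)]
  exact anti.le_of_tendsto
    (multipliable_one_sub (summable_pow_succ h0.le h1)).hasProd.tendsto_prod_nat n

lemma prod_range_one_sub_pow_mem {q : ℝ} (h0 : 0 < q) (h1 : q < 1) (n : ℕ) :
    0 < ∏ k ∈ Finset.range n, (1 - q ^ (k + 1)) ∧ ∏ k ∈ Finset.range n, (1 - q ^ (k + 1)) ≤ 1 := by
  have hk (k : ℕ) : 0 < 1 - q ^ (k + 1) := by linarith [pow_lt_one₀ h0.le h1 k.add_one_ne_zero]
  exact ⟨Finset.prod_pos fun k _ ↦ hk k, Finset.prod_le_one (fun k _ ↦ (hk k).le)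
    fun k _ ↦ by linarith [pow_pos h0 (k + 1)]⟩

lemma gaussBinom_nonneg {p : ℝ} (h0 : 0 < p) (M j : ℕ) : 0 ≤ gaussBinom p M j := by
  induction M generalizing j with
  | zero => cases j <;> simp [gaussBinom]
  | succ M ih =>
    cases j with
    | zero => simp [gaussBinom]
    | succ j =>
      rw [gaussBinom_succ_succ]
      have := ih j
      have := ih (j + 1)
      positivity

lemma gaussBinom_le {p : ℝ} (h0 : 0 < p) (h1 : p < 1) (M j : ℕ) :
    gaussBinom p M j ≤ 1 / eulerF p ^ 2 := by
  have hpos := eulerF_pos h0 h1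
  rcases lt_or_ge M j with h | h
  · rw [gaussBinom_eq_zero p h]
    positivity
  obtain ⟨b, rfl⟩ := Nat.exists_eq_add_of_le h
  rw [le_div_iff₀ (by positivity)]
  refine le_trans ?_ ((gaussBinom_mul_prod_mul_prod p j b).trans_le
    (prod_range_one_sub_pow_mem h0 h1 (j + b)).2)
  refine mul_le_mul_of_nonneg_left ?_ (gaussBinom_nonneg h0 _ _)
  rw [sq]
  exact mul_le_mul (eulerF_le_prod_range h0 h1 j) (eulerF_le_prod_range h0 h1 b) hpos.le
    (prod_range_one_sub_pow_mem h0 h1 j).1.le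

lemma tendsto_gaussBinom {p : ℝ} (h0 : 0 < p) (h1 : p < 1) {a b : ℕ → ℕ}
    (ha : Filter.Tendsto a .atTop .atTop) (hb : Filter.Tendsto b .atTop .atTop) :
    Filter.Tendsto (fun N ↦ gaussBinom p (a N + b N) (a N)) .atTop (nhds (1 / eulerF p)) := by
  have h := (multipliable_one_sub (summable_pow_succ h0.le h1)).hasProd.tendsto_prod_nat
  change Filter.Tendsto _ _ (nhds (eulerF p)) at h
  have hpos := eulerF_pos h0 h1
  have := (h.comp (ha.atTop_add_atTop hb)).div ((h.comp ha).mul (h.comp hb)) (by positivity)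
  rw [div_mul_cancel_left₀ hpos.ne', ← one_div] at this
  refine this.congr fun N ↦ ?_
  have hp := prod_range_one_sub_pow_mem h0 h1
  exact (eq_div_of_mul_eq (mul_pos (hp _).1 (hp _).1).ne'
    (gaussBinom_mul_prod_mul_prod p (a N) (b N))).symm

lemma prod_range_one_sub_exp_neg (r α : ℝ) (N : ℕ) :
    ∏ k ∈ Finset.range N, (1 - exp (r * (k + α))) =
      (-1) ^ N * exp (r * (N * (N - 1) / 2 + N * α)) *
        ∏ k ∈ Finset.range N, (1 - exp (-r * (k + α))) := by
  induction N with
  | zero => simp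
  | succ N ih =>
    have e1 : exp (r * (((N + 1 : ℕ) : ℝ) * (((N + 1 : ℕ) : ℝ) - 1) / 2 + ((N + 1 : ℕ) : ℝ) * α)) =
        exp (r * (N * (N - 1) / 2 + N * α)) * exp (r * (N + α)) := by
      rw [← exp_add]; push_cast; ring_nf
    have e2 : exp (r * (N + α)) * exp (-r * (N + α)) = 1 := by
      rw [← exp_add, ← exp_zero]; ring_nf
    rw [Finset.prod_range_succ, Finset.prod_range_succ, ih, e1]
    linear_combination -(-1) ^ N * exp (r * (N * (N - 1) / 2 + N * α)) *
      (∏ k ∈ Finset.range N, (1 - exp (-r * (k + α)))) * e2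

/-- The Jacobi triple product in finite form. -/
lemma prod_range_mul_prod_range_eq_sum (r α : ℝ) (N : ℕ) :
    (∏ k ∈ Finset.range N, (1 - exp (-r * (k + (1 - α))))) *
      ∏ k ∈ Finset.range N, (1 - exp (-r * (k + α))) =
    ∑ j ∈ Finset.range (2 * N + 1), (-1) ^ N * (-1) ^ j *
      exp (-r * (((j : ℝ) - N) * (j - N - 1) / 2 + (j - N) * (1 - α))) *
        gaussBinom (exp (-r)) (2 * N) j := by
  have key := prod_one_add_mul_pow (exp (-r)) (-exp (r * (N - (1 - α)))) (2 * N)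
  have hl : ∏ k ∈ Finset.range (2 * N), (1 + -exp (r * (N - (1 - α))) * exp (-r) ^ k) =
      (∏ k ∈ Finset.range N, (1 - exp (r * (k + α)))) *
        ∏ k ∈ Finset.range N, (1 - exp (-r * (k + (1 - α)))) := by
    rw [two_mul, Finset.prod_range_add, ← Finset.prod_range_reflect]
    congr 1
    · refine Finset.prod_congr rfl fun k hk ↦ ?_
      have hk' := Finset.mem_range.1 hk
      rw [neg_mul, ← exp_nat_mul, ← exp_add, ← sub_eq_add_neg, Nat.sub_sub,
        Nat.cast_sub (by omega)]
      push_cast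
      ring_nf
    · refine Finset.prod_congr rfl fun k _ ↦ ?_
      rw [neg_mul, ← exp_nat_mul, ← exp_add, ← sub_eq_add_neg]
      push_cast
      ring_nf
  rw [hl, prod_range_one_sub_exp_neg] at key
  have hN : ((-1 : ℝ) ^ N) * (-1) ^ N = 1 := by rw [← mul_pow]; norm_num
  have hE : exp (-(r * (N * (N - 1) / 2 + N * α))) * exp (r * (N * (N - 1) / 2 + N * α)) = 1 := by
    rw [← exp_add, neg_add_cancel, exp_zero]
  trans (-1) ^ N * exp (-(r * (N * (N - 1) / 2 + N * α))) *
    ∑ j ∈ Finset.range (2 * N + 1), exp (-r) ^ (j.choose 2) * gaussBinom (exp (-r)) (2 * N) j *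
      (-exp (r * (N - (1 - α)))) ^ j
  · rw [← key]
    generalize (∏ k ∈ Finset.range N, (1 - exp (-r * (k + (1 - α))))) = A
    generalize (∏ k ∈ Finset.range N, (1 - exp (-r * (k + α)))) = B
    linear_combination (-A * B) * hE -
      A * B * exp (-(r * (N * (N - 1) / 2 + N * α))) * exp (r * (N * (N - 1) / 2 + N * α)) * hN
  · rw [Finset.mul_sum]
    refine Finset.sum_congr rfl fun j _ ↦ ?_
    have : exp (-r * (((j : ℝ) - N) * (j - N - 1) / 2 + (j - N) * (1 - α))) =
        exp (-(r * (N * (N - 1) / 2 + N * α))) *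
          (exp (-r) ^ (j.choose 2) * exp (r * (N - (1 - α))) ^ j) := by
      rw [← exp_nat_mul, ← exp_nat_mul, ← exp_add, ← exp_add, Nat.cast_choose_two]
      congr 1
      ring
    rw [this, neg_pow (exp _) j]
    ring

lemma summable_exp_neg_mul_add {r : ℝ} (hr : 0 < r) (c : ℝ) :
    Summable fun k : ℕ ↦ exp (-r * (k + c)) := by
  refine ((summable_geometric_of_lt_one (exp_pos (-r)).le
    (exp_lt_one_iff.2 (neg_lt_zero.2 hr))).mul_right (exp (-r * c))).congr fun k ↦ ?_
  rw [← exp_nat_mul, ← exp_add]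
  ring_nf

/-- The coefficients of the finite triple product, extended by zero to all integers. -/
noncomputable def centralGaussBinom (p : ℝ) (N : ℕ) (n : ℤ) : ℝ :=
  if 0 ≤ n + N then gaussBinom p (2 * N) (n + N).toNat else 0

lemma abs_centralGaussBinom_le {p : ℝ} (h0 : 0 < p) (h1 : p < 1) (N : ℕ) (n : ℤ) :
    |centralGaussBinom p N n| ≤ 1 / eulerF p ^ 2 := by
  unfold centralGaussBinom
  split_ifs
  · rw [abs_of_nonneg (gaussBinom_nonneg h0 _ _)]
    exact gaussBinom_le h0 h1 _ _
  · rw [abs_zero]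
    positivity

lemma tendsto_centralGaussBinom {p : ℝ} (h0 : 0 < p) (h1 : p < 1) (n : ℤ) :
    Filter.Tendsto (fun N ↦ centralGaussBinom p N n) .atTop (nhds (1 / eulerF p)) := by
  have ha : Filter.Tendsto (fun N : ℕ ↦ (n + N).toNat) .atTop .atTop :=
    Filter.tendsto_atTop.2 fun b ↦ by
      filter_upwards [Filter.eventually_ge_atTop (b + n.natAbs)] with N hN
      omega
  have hb : Filter.Tendsto (fun N : ℕ ↦ (N - n).toNat) .atTop .atTop :=
    Filter.tendsto_atTop.2 fun b ↦ by
      filter_upwards [Filter.eventually_ge_atTop (b + n.natAbs)] with N hN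
      omega
  refine (tendsto_gaussBinom h0 h1 ha hb).congr' ?_
  filter_upwards [Filter.eventually_ge_atTop n.natAbs] with N hN
  rw [centralGaussBinom, if_pos (by omega), show (n + N).toNat + (N - n).toNat = 2 * N by omega]

lemma tsum_mul_centralGaussBinom (p : ℝ) (N : ℕ) (f : ℤ → ℝ) :
    ∑' n, f n * centralGaussBinom p N n =
      ∑ j ∈ Finset.range (2 * N + 1), f (j - N) * gaussBinom p (2 * N) j := by
  rw [← (Equiv.subRight (N : ℤ)).tsum_eq, tsum_eq_sum
    (s := (Finset.range (2 * N + 1)).map Nat.castEmbedding), Finset.sum_map]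
  · refine Finset.sum_congr rfl fun j _ ↦ ?_
    simp [centralGaussBinom]
  · intro m hm
    rw [Equiv.subRight_apply, centralGaussBinom, sub_add_cancel]
    split_ifs with h
    · rw [gaussBinom_eq_zero, mul_zero]
      by_contra! h'
      exact hm (Finset.mem_map.2 ⟨m.toNat, Finset.mem_range.2 (by omega), by simp [h]⟩)
    · rw [mul_zero]

/-- The Jacobi triple product identity. -/
lemma gaussMoment_zero_eq_tprod {r : ℝ} (hr : 0 < r) (α : ℝ) :
    gaussMoment 0 r α = exp (-r * (1 / 2 - α) ^ 2 / 2) * (eulerF (exp (-r)) *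
      ((∏' k : ℕ, (1 - exp (-r * (k + (1 - α))))) * ∏' k : ℕ, (1 - exp (-r * (k + α))))) := by
  have h0 := exp_pos (-r)
  have h1 : exp (-r) < 1 := exp_lt_one_iff.2 (neg_lt_zero.2 hr)
  have hpos := eulerF_pos h0 h1
  let T (n : ℤ) : ℝ := (-1 : ℝ) ^ n * (n + 1 / 2 - α) ^ 0 * exp (-r * (n + 1 / 2 - α) ^ 2 / 2)
  have hT : Summable T := summable_gaussMoment 0 hr α
  have lim1 := tendsto_tsum_of_dominated_convergence (𝓕 := Filter.atTop)
    (f := fun N n ↦ T n * centralGaussBinom (exp (-r)) N n) (hT.abs.mul_right (1 / eulerF (exp (-r)) ^ 2))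
    (fun n ↦ (tendsto_centralGaussBinom h0 h1 n).const_mul (T n))
    (.of_forall fun N n ↦ by
      rw [norm_mul]
      exact mul_le_mul_of_nonneg_left (abs_centralGaussBinom_le h0 h1 N n) (norm_nonneg _))
  have lim2 := (((multipliable_one_sub (summable_exp_neg_mul_add hr (1 - α))).hasProd.tendsto_prod_nat.mul
    (multipliable_one_sub (summable_exp_neg_mul_add hr α)).hasProd.tendsto_prod_nat)).const_mul
      (exp (-r * (1 / 2 - α) ^ 2 / 2))
  have := tendsto_nhds_unique (lim1.congr fun N ↦ ?_) lim2
  · rw [tsum_mul_right, mul_one_div, div_eq_iff hpos.ne'] at this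
    rw [gaussMoment, this]
    ring
  · rw [tsum_mul_centralGaussBinom, prod_range_mul_prod_range_eq_sum, Finset.mul_sum]
    refine Finset.sum_congr rfl fun j _ ↦ ?_
    have hs : (-1 : ℝ) ^ ((j : ℤ) - N) = (-1) ^ N * (-1) ^ j := by
      rw [zpow_sub₀ (by norm_num), zpow_natCast, zpow_natCast, div_eq_iff (by positivity)]
      have : ((-1 : ℝ) ^ N) * (-1) ^ N = 1 := by rw [← mul_pow]; norm_num
      linear_combination -(-1 : ℝ) ^ j * this
    have he : exp (-r * (((j - N : ℤ) : ℝ) + 1 / 2 - α) ^ 2 / 2) = exp (-r * (1 / 2 - α) ^ 2 / 2) *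
        exp (-r * (((j : ℝ) - N) * (j - N - 1) / 2 + (j - N) * (1 - α))) := by
      rw [← exp_add]
      congr 1
      push_cast
      ring
    simp only [T, hs, he, pow_zero]
    ring

/-- The infinite product `∏ (1 - exp (-r (k + c)))`. -/
noncomputable def expProd (r c : ℝ) : ℝ := ∏' k : ℕ, (1 - exp (-r * (k + c)))

lemma expProd_pos {r c : ℝ} (hr : 0 < r) (hc : 0 < c) : 0 < expProd r c :=
  tprod_one_sub_pos (summable_exp_neg_mul_add hr c) fun k ↦ by
    rw [exp_lt_one_iff, neg_mul, neg_lt_zero]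
    positivity

lemma tendsto_expProd_atTop {c : ℝ} (hc : 0 < c) :
    Filter.Tendsto (fun r ↦ expProd r c) .atTop (nhds 1) := by
  have := tendsto_tprod_one_add_of_dominated_convergence (𝓕 := Filter.atTop)
    (f := fun (r : ℝ) (k : ℕ) ↦ -exp (-r * (k + c))) (g := fun _ ↦ 0)
    (summable_exp_neg_mul_add one_pos c) (fun k ↦ ?_) ?_
  · simpa only [expProd, ← sub_eq_add_neg, add_zero, tprod_one] using this
  · rw [← neg_zero]
    refine (tendsto_exp_atBot.comp ?_).neg
    have hk : 0 < (k : ℝ) + c := by positivity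
    exact Filter.tendsto_neg_atTop_atBot.atBot_mul_const hk
  · filter_upwards [Filter.eventually_ge_atTop 1] with r hr k
    have hk : 0 < (k : ℝ) + c := by positivity
    rw [norm_neg, norm_eq_abs, abs_exp, exp_le_exp]
    nlinarith

lemma continuousAt_expProd {r c : ℝ} (hr : 0 < r) : ContinuousAt (expProd r) c := by
  have := tendsto_tprod_one_add_of_dominated_convergence (𝓕 := nhds c)
    (f := fun (x : ℝ) (k : ℕ) ↦ -exp (-r * (k + x))) (g := fun k : ℕ ↦ -exp (-r * (k + c)))
    (summable_exp_neg_mul_add hr (c - 1)) (fun k ↦ ?_) ?_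
  · simp only [← sub_eq_add_neg] at this
    exact this
  · exact Continuous.tendsto (by fun_prop) c
  · filter_upwards [lt_mem_nhds (sub_one_lt c)] with x hx k
    rw [norm_neg, norm_eq_abs, abs_exp, exp_le_exp]
    nlinarith

lemma eulerF_exp_neg (r : ℝ) : eulerF (exp (-r)) = expProd r 1 := by
  refine tprod_congr fun k ↦ ?_
  rw [← exp_nat_mul]
  push_cast
  ring_nf

lemma eulerF_exp_neg_div_five {r : ℝ} (hr : 0 < r) : eulerF (exp (-r / 5)) =
    expProd r (1 / 5) * expProd r (2 / 5) * expProd r (3 / 5) * expProd r (4 / 5) * expProd r 1 := by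
  have h1 : exp (-r / 5) < 1 := exp_lt_one_iff.2 (by linarith)
  have lim (c : ℝ) := (multipliable_one_sub (summable_exp_neg_mul_add hr c)).hasProd.tendsto_prod_nat
  have lim1 := (multipliable_one_sub (summable_pow_succ (exp_pos _).le h1)).hasProd.tendsto_prod_nat
  have h5 : Filter.Tendsto (fun N : ℕ ↦ 5 * N) .atTop .atTop :=
    Filter.tendsto_id.const_mul_atTop' (by norm_num)
  refine tendsto_nhds_unique ((lim1.comp h5).congr fun N ↦ ?_)
    (((((lim (1 / 5)).mul (lim (2 / 5))).mul (lim (3 / 5))).mul (lim (4 / 5))).mul (lim 1))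
  induction N with
  | zero => simp
  | succ N ih =>
    have e (i : ℕ) : exp (-r / 5) ^ (5 * N + i) = exp (-r * (N + i / 5)) := by
      rw [← exp_nat_mul]
      push_cast
      ring_nf
    have e1 := e 1
    have e2 := e 2
    have e3 := e 3
    have e4 := e 4
    have e5 := e 5
    push_cast at e1 e2 e3 e4 e5
    rw [show (5 : ℝ) / 5 = 1 by norm_num] at e5
    simp only [Function.comp_apply] at ih ⊢
    rw [mul_add_one]
    simp only [Finset.prod_range_succ, Nat.add_assoc, Nat.reduceAdd, e1, e2, e3, e4, e5]
    rw [ih]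
    ring

lemma gaussMoment_zero_eq {r : ℝ} (hr : 0 < r) (α : ℝ) : gaussMoment 0 r α =
    exp (-r * (1 / 2 - α) ^ 2 / 2) * (expProd r 1 * (expProd r (1 - α) * expProd r α)) := by
  rw [gaussMoment_zero_eq_tprod hr, eulerF_exp_neg]
  rfl

lemma gaussMoment_zero_pos {r α : ℝ} (hr : 0 < r) (h0 : 0 < α) (h1 : α < 1) :
    0 < gaussMoment 0 r α := by
  have := expProd_pos hr one_pos
  have := expProd_pos hr h0
  have := expProd_pos hr (sub_pos.2 h1)
  rw [gaussMoment_zero_eq hr]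
  positivity

lemma expProd_eq_mul {r : ℝ} (hr : 0 < r) (c : ℝ) :
    expProd r c = (1 - exp (-(r * c))) * expProd r (1 + c) := by
  have hm := multipliable_one_sub (summable_exp_neg_mul_add hr (1 + c))
  have := tprod_eq_zero_mul' (f := fun k : ℕ ↦ 1 - exp (-r * (k + c)))
    (hm.congr fun k ↦ by push_cast; ring_nf)
  rw [expProd, this, expProd]
  congr 1
  · simp
  · refine tprod_congr fun k ↦ ?_
    push_cast
    ring_nf

lemma gaussMoment_one_zero {r : ℝ} (hr : 0 < r) :
    gaussMoment 1 r 0 = exp (-r / 8) * expProd r 1 ^ 3 := by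
  have h1 := (hasDerivAt_gaussMoment 0 hr 0).tendsto_slope_zero
  have hd : HasDerivAt (fun t ↦ 1 - exp (-(r * t))) r 0 := by
    simpa using ((((hasDerivAt_id (0 : ℝ)).const_mul r).neg).exp).const_sub 1
  have h2 := hd.tendsto_slope_zero
  have hc : Filter.Tendsto (fun t : ℝ ↦ exp (-r * (1 / 2 - t) ^ 2 / 2) *
      (expProd r 1 * (expProd r (1 - t) * expProd r (1 + t)))) (nhdsWithin 0 {0}ᶜ)
      (nhds (exp (-r * (1 / 2 - 0) ^ 2 / 2) *
      (expProd r 1 * (expProd r (1 - 0) * expProd r (1 + 0))))) := by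
    refine Filter.Tendsto.mono_left (ContinuousAt.tendsto ?_) nhdsWithin_le_nhds
    have c1 : ContinuousAt (fun t : ℝ ↦ expProd r (1 - t)) 0 :=
      (continuousAt_expProd hr).comp (f := fun t : ℝ ↦ 1 - t) (by fun_prop)
    have c2 : ContinuousAt (fun t : ℝ ↦ expProd r (1 + t)) 0 :=
      (continuousAt_expProd hr).comp (f := fun t : ℝ ↦ 1 + t) (by fun_prop)
    fun_prop
  have := tendsto_nhds_unique (h1.congr fun t ↦ ?_) (hc.mul h2)
  · simp only [zero_add, Nat.cast_zero, zero_mul, sub_zero, add_zero] at this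
    rw [show -r / 8 = -r * (1 / 2) ^ 2 / 2 by ring]
    apply mul_left_cancel₀ hr.ne'
    linear_combination this
  · rw [gaussMoment_zero_zero, gaussMoment_zero_eq hr, expProd_eq_mul hr (0 + t)]
    simp
    ring

lemma gaussMoment_one_zero_pos {r : ℝ} (hr : 0 < r) : 0 < gaussMoment 1 r 0 := by
  have := expProd_pos hr one_pos
  rw [gaussMoment_one_zero hr]
  positivity

lemma gaussMoment_fifths {r : ℝ} (hr : 0 < r) :
    gaussMoment 0 r (1 / 5) * gaussMoment 0 r (2 / 5) =
      exp (-r / 20) * (eulerF (exp (-r / 5)) * eulerF (exp (-r))) := by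
  have : exp (-r / 20) = exp (-r * (1 / 2 - 1 / 5) ^ 2 / 2) * exp (-r * (1 / 2 - 2 / 5) ^ 2 / 2) := by
    rw [← exp_add]
    ring_nf
  rw [gaussMoment_zero_eq hr, gaussMoment_zero_eq hr, eulerF_exp_neg, eulerF_exp_neg_div_five hr,
    this]
  norm_num
  ring

lemma gaussMoment_one_sub (k : ℕ) (r α : ℝ) :
    gaussMoment k r (1 - α) = (-1) ^ k * gaussMoment k r α := by
  rw [sub_eq_neg_add, gaussMoment_add_one, gaussMoment_neg]
  ring

lemma gaussMoment_one_one_fifth_div {r : ℝ} (hr : 0 < r) :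
    gaussMoment 1 r (1 / 5) / gaussMoment 0 r (1 / 5) =
      (3 * (gaussMoment 1 r 0 * gaussMoment 0 r (2 / 5) ^ 2 / gaussMoment 0 r (1 / 5) ^ 3) +
        gaussMoment 1 r 0 * gaussMoment 0 r (1 / 5) ^ 2 / gaussMoment 0 r (2 / 5) ^ 3) / 10 ∧
    gaussMoment 1 r (2 / 5) / gaussMoment 0 r (2 / 5) =
      (gaussMoment 1 r 0 * gaussMoment 0 r (2 / 5) ^ 2 / gaussMoment 0 r (1 / 5) ^ 3 -
        3 * (gaussMoment 1 r 0 * gaussMoment 0 r (1 / 5) ^ 2 / gaussMoment 0 r (2 / 5) ^ 3)) / 10 := by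
  have ha : 0 < gaussMoment 0 r (1 / 5) := gaussMoment_zero_pos hr (by norm_num) (by norm_num)
  have hb : 0 < gaussMoment 0 r (2 / 5) := gaussMoment_zero_pos hr (by norm_num) (by norm_num)
  have e1 := gaussMoment_triplication_deriv hr (1 / 5)
  have e2 := gaussMoment_triplication_deriv hr (2 / 5)
  rw [show (3 : ℝ) * (1 / 5) = 1 - 2 / 5 by norm_num, show (2 : ℝ) * (1 / 5) = 2 / 5 by norm_num,
    gaussMoment_one_sub, gaussMoment_one_sub] at e1
  rw [show (3 : ℝ) * (2 / 5) = 1 / 5 + 1 by norm_num, show (2 : ℝ) * (2 / 5) = 1 - 1 / 5 by norm_num,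
    gaussMoment_one_sub, gaussMoment_add_one, gaussMoment_add_one] at e2
  generalize gaussMoment 0 r (1 / 5) = a at *
  generalize gaussMoment 0 r (2 / 5) = b at *
  have h1 : 3 * (gaussMoment 1 r (1 / 5) / a) + gaussMoment 1 r (2 / 5) / b =
      gaussMoment 1 r 0 * b ^ 2 / a ^ 3 := by
    field_simp
    linear_combination e1
  have h2 : gaussMoment 1 r (1 / 5) / a - 3 * (gaussMoment 1 r (2 / 5) / b) =
      gaussMoment 1 r 0 * a ^ 2 / b ^ 3 := by
    field_simp
    linear_combination e2
  exact ⟨by linear_combination 3 / 10 * h1 + h2 / 10, by linear_combination h1 / 10 - 3 / 10 * h2⟩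

lemma gaussMoment_two_fifths_div {r : ℝ} (hr : 0 < r) {a b a₂ b₂ C D : ℝ}
    (ha : a = gaussMoment 0 r (1 / 5)) (hb : b = gaussMoment 0 r (2 / 5))
    (ha₂ : a₂ = gaussMoment 2 r (1 / 5)) (hb₂ : b₂ = gaussMoment 2 r (2 / 5))
    (hC : C = gaussMoment 1 r 0) (hD : D = gaussMoment 3 r 0) :
    2 * (D / C) - 3 * (a₂ / a + b₂ / b) =
      ((C * b ^ 2 / a ^ 3) ^ 2 + (C * a ^ 2 / b ^ 3) ^ 2) / 5 ∧
    a₂ / a - b₂ / b = 2 / 25 * ((C * b ^ 2 / a ^ 3) ^ 2 -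
      11 * ((C * b ^ 2 / a ^ 3) * (C * a ^ 2 / b ^ 3)) - (C * a ^ 2 / b ^ 3) ^ 2) := by
  have ha0 : 0 < a := ha ▸ gaussMoment_zero_pos hr (by norm_num) (by norm_num)
  have hb0 : 0 < b := hb ▸ gaussMoment_zero_pos hr (by norm_num) (by norm_num)
  have hC0 : 0 < C := hC ▸ gaussMoment_one_zero_pos hr
  obtain ⟨h1, h2⟩ := gaussMoment_one_one_fifth_div hr
  have e1 := gaussMoment_duplication_deriv hr (1 / 5)
  have e2 := gaussMoment_duplication_deriv hr (2 / 5)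
  rw [show (2 : ℝ) * (1 / 5) = 2 / 5 by norm_num] at e1
  rw [show (2 : ℝ) * (2 / 5) = 1 - 1 / 5 by norm_num, gaussMoment_one_sub, gaussMoment_one_sub,
    gaussMoment_one_sub] at e2
  rw [← ha, ← hb, ← hC] at h1 h2
  rw [← ha, ← hb, ← ha₂, ← hb₂, ← hC, ← hD] at e1 e2
  generalize gaussMoment 1 r (1 / 5) = a₁ at *
  generalize gaussMoment 1 r (2 / 5) = b₁ at *
  clear ha hb ha₂ hb₂ hC hD
  generalize C * b ^ 2 / a ^ 3 = M at *
  generalize C * a ^ 2 / b ^ 3 = N at *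
  have k1 : D / C = b₂ / b + 2 * (a₂ / a) - 4 * (a₁ / a) * (b₁ / b) + 2 * (a₁ / a) ^ 2 := by
    field_simp
    apply mul_left_cancel₀ (pow_pos hr 2).ne'
    linear_combination e1
  have k2 : D / C = a₂ / a + 2 * (b₂ / b) + 4 * (a₁ / a) * (b₁ / b) + 2 * (b₁ / b) ^ 2 := by
    field_simp
    apply mul_left_cancel₀ (pow_pos hr 2).ne'
    linear_combination e2
  rw [h1, h2] at k1 k2
  exact ⟨by linear_combination k1 + k2, by linear_combination k2 - k1⟩

/-- The function `a⁶ b⁶ / C⁴` of the rate, where `a` and `b` are the theta values at `1/5` and `2/5`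
and `C` is the theta derivative at the origin. -/
noncomputable def thetaQuotient (r : ℝ) : ℝ :=
  gaussMoment 0 r (1 / 5) ^ 6 * gaussMoment 0 r (2 / 5) ^ 6 / gaussMoment 1 r 0 ^ 4

/-- The fifth power of the ratio of the theta values at `2/5` and `1/5`. -/
noncomputable def thetaRatio (r : ℝ) : ℝ :=
  (gaussMoment 0 r (2 / 5) / gaussMoment 0 r (1 / 5)) ^ 5

lemma thetaRatio_pos {r : ℝ} (hr : 0 < r) : 0 < thetaRatio r :=
  pow_pos (div_pos (gaussMoment_zero_pos hr (by norm_num) (by norm_num))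
    (gaussMoment_zero_pos hr (by norm_num) (by norm_num))) 5

lemma thetaQuotient_pos {r : ℝ} (hr : 0 < r) : 0 < thetaQuotient r :=
  div_pos (mul_pos (pow_pos (gaussMoment_zero_pos hr (by norm_num) (by norm_num)) 6)
    (pow_pos (gaussMoment_zero_pos hr (by norm_num) (by norm_num)) 6))
    (pow_pos (gaussMoment_one_zero_pos hr) 4)

lemma hasDerivAt_thetaQuotient {r : ℝ} (hr : 0 < r) :
    HasDerivAt thetaQuotient (thetaQuotient r * (gaussMoment 1 r 0 ^ 2 /
      (gaussMoment 0 r (1 / 5) * gaussMoment 0 r (2 / 5)) *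
        (thetaRatio r + (thetaRatio r)⁻¹) / 5)) r := by
  have ha : 0 < gaussMoment 0 r (1 / 5) := gaussMoment_zero_pos hr (by norm_num) (by norm_num)
  have hb : 0 < gaussMoment 0 r (2 / 5) := gaussMoment_zero_pos hr (by norm_num) (by norm_num)
  have hC := gaussMoment_one_zero_pos hr
  have key := (gaussMoment_two_fifths_div hr rfl rfl rfl rfl rfl rfl).1
  refine ((((hasDerivAt_gaussMoment_rate 0 hr (1 / 5)).pow 6).mul
    ((hasDerivAt_gaussMoment_rate 0 hr (2 / 5)).pow 6)).div
    ((hasDerivAt_gaussMoment_rate 1 hr 0).pow 4) (pow_pos hC 4).ne').congr_deriv ?_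
  simp only [thetaQuotient, thetaRatio, Pi.mul_apply, Pi.pow_apply, zero_add, Nat.reduceAdd]
  generalize gaussMoment 0 r (1 / 5) = a at *
  generalize gaussMoment 0 r (2 / 5) = b at *
  generalize gaussMoment 1 r 0 = C at *
  trans a ^ 6 * b ^ 6 / C ^ 4 * (2 * (gaussMoment 3 r 0 / C) -
    3 * (gaussMoment 2 r (1 / 5) / a + gaussMoment 2 r (2 / 5) / b))
  · field_simp
    norm_num
    ring
  · rw [key]
    field_simp

lemma hasDerivAt_thetaRatio_sub {r : ℝ} (hr : 0 < r) :
    HasDerivAt (fun r ↦ thetaRatio r - 11 - (thetaRatio r)⁻¹)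
      ((thetaRatio r - 11 - (thetaRatio r)⁻¹) * (gaussMoment 1 r 0 ^ 2 /
      (gaussMoment 0 r (1 / 5) * gaussMoment 0 r (2 / 5)) *
        (thetaRatio r + (thetaRatio r)⁻¹) / 5)) r := by
  have ha : 0 < gaussMoment 0 r (1 / 5) := gaussMoment_zero_pos hr (by norm_num) (by norm_num)
  have hb : 0 < gaussMoment 0 r (2 / 5) := gaussMoment_zero_pos hr (by norm_num) (by norm_num)
  have key := (gaussMoment_two_fifths_div hr rfl rfl rfl rfl rfl rfl).2
  have hρ : HasDerivAt thetaRatio (thetaRatio r * (gaussMoment 1 r 0 ^ 2 /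
      (gaussMoment 0 r (1 / 5) * gaussMoment 0 r (2 / 5)) *
        (thetaRatio r - 11 - (thetaRatio r)⁻¹) / 5)) r := by
    refine (((hasDerivAt_gaussMoment_rate 0 hr (2 / 5)).div
      (hasDerivAt_gaussMoment_rate 0 hr (1 / 5)) ha.ne').pow 5).congr_deriv ?_
    simp only [thetaRatio, Pi.div_apply, zero_add, Nat.add_one_sub_one, div_pow]
    generalize gaussMoment 0 r (1 / 5) = a at *
    generalize gaussMoment 0 r (2 / 5) = b at *
    trans b ^ 5 / a ^ 5 * (5 / 2 * (gaussMoment 2 r (1 / 5) / a - gaussMoment 2 r (2 / 5) / b))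
    · field_simp
      norm_num
      ring
    · rw [key]
      field_simp
      ring
  have hpos := thetaRatio_pos hr
  refine ((hρ.sub_const 11).sub (hρ.inv hpos.ne')).congr_deriv ?_
  field_simp
  ring

lemma thetaRatio_eq {r : ℝ} (hr : 0 < r) : thetaRatio r = exp (r / 5) *
    (expProd r (3 / 5) * expProd r (2 / 5) / (expProd r (4 / 5) * expProd r (1 / 5))) ^ 5 := by
  have h1 := expProd_pos hr one_pos
  have h2 := expProd_pos hr (show (0 : ℝ) < 4 / 5 by norm_num)
  have h3 := expProd_pos hr (show (0 : ℝ) < 1 / 5 by norm_num)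
  have he : exp (-r * (1 / 2 - 2 / 5) ^ 2 / 2) =
      exp (r / 25) * exp (-r * (1 / 2 - 1 / 5) ^ 2 / 2) := by
    rw [← exp_add]
    ring_nf
  have he' : exp (r / 5) = exp (r / 25) ^ 5 := by
    rw [← exp_nat_mul]
    ring_nf
  rw [thetaRatio, gaussMoment_zero_eq hr, gaussMoment_zero_eq hr, he, he',
    show (1 : ℝ) - 2 / 5 = 3 / 5 by norm_num, show (1 : ℝ) - 1 / 5 = 4 / 5 by norm_num, ← mul_pow]
  congr 1
  field_simp

lemma thetaQuotient_eq {r : ℝ} (hr : 0 < r) : thetaQuotient r = exp (r / 5) *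
    (eulerF (exp (-r / 5)) / eulerF (exp (-r))) ^ 6 := by
  have h1 := expProd_pos hr one_pos
  have he : exp (-r / 20) ^ 6 = exp (r / 5) * exp (-r / 8) ^ 4 := by
    rw [← exp_nat_mul, ← exp_nat_mul, ← exp_add]
    ring_nf
  rw [thetaQuotient, ← mul_pow, gaussMoment_fifths hr, gaussMoment_one_zero hr, eulerF_exp_neg,
    mul_pow, he]
  field_simp

lemma uF_exp_neg_div_five {r : ℝ} (hr : 0 < r) : uF (exp (-r / 5)) = thetaQuotient r := by
  have h5 : exp (-r / 5) ^ 5 = exp (-r) := by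
    rw [← exp_nat_mul]
    ring_nf
  have he : exp (r / 5) = (exp (-r / 5))⁻¹ := by
    rw [← exp_neg]
    ring_nf
  rw [thetaQuotient_eq hr, uF, h5, he, div_pow]
  field_simp

lemma tendsto_thetaRatio_sub_div_thetaQuotient :
    Filter.Tendsto (fun r ↦ (thetaRatio r - 11 - (thetaRatio r)⁻¹) / thetaQuotient r) .atTop
      (nhds 1) := by
  have l (c : ℝ) (hc : 0 < c) := tendsto_expProd_atTop hc
  have l1 := l (1 / 5) (by norm_num)
  have l2 := l (2 / 5) (by norm_num)
  have l3 := l (3 / 5) (by norm_num)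
  have l4 := l (4 / 5) (by norm_num)
  have lX := ((l3.mul l2).div (l4.mul l1) (by norm_num)).pow 5
  have lY := (((l1.mul l2).mul l3).mul l4).pow 6
  have lE : Filter.Tendsto (fun r : ℝ ↦ exp (-(r / 5))) .atTop (nhds 0) :=
    tendsto_exp_neg_atTop_nhds_zero.comp (Filter.tendsto_id.atTop_div_const (by norm_num))
  have := ((lX.sub (lE.const_mul 11)).sub ((lE.pow 2).mul (lX.inv₀ (by norm_num)))).div lY
    (by norm_num)
  norm_num at this
  refine this.congr' ?_
  filter_upwards [Filter.eventually_gt_atTop 0] with r hr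
  have h1 := expProd_pos hr one_pos
  have h2 := expProd_pos hr (show (0 : ℝ) < 4 / 5 by norm_num)
  have h3 := expProd_pos hr (show (0 : ℝ) < 1 / 5 by norm_num)
  have h4 := expProd_pos hr (show (0 : ℝ) < 2 / 5 by norm_num)
  have h5 := expProd_pos hr (show (0 : ℝ) < 3 / 5 by norm_num)
  rw [thetaRatio_eq hr, thetaQuotient_eq hr, eulerF_exp_neg_div_five hr, eulerF_exp_neg,
    mul_div_cancel_right₀ _ h1.ne', Pi.div_apply, exp_neg]
  field_simp

lemma thetaQuotient_eq_thetaRatio_sub {r : ℝ} (hr : 0 < r) :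
    thetaQuotient r = thetaRatio r - 11 - (thetaRatio r)⁻¹ := by
  set S : ℝ → ℝ := fun r ↦ (thetaRatio r - 11 - (thetaRatio r)⁻¹) / thetaQuotient r
  have hd (r : ℝ) (hr : 0 < r) : HasDerivAt S 0 r := by
    refine ((hasDerivAt_thetaRatio_sub hr).div (hasDerivAt_thetaQuotient hr)
      (thetaQuotient_pos hr).ne').congr_deriv ?_
    ring
  have hconst (s : ℝ) (hs : 0 < s) : S s = S r :=
    isOpen_Ioi.is_const_of_deriv_eq_zero isPreconnected_Ioi
      (fun x hx ↦ (hd x hx).differentiableAt.differentiableWithinAt) (fun x hx ↦ (hd x hx).deriv) hs hr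
  have hlim : Filter.Tendsto S .atTop (nhds (S r)) :=
    tendsto_const_nhds.congr' (by
      filter_upwards [Filter.eventually_gt_atTop 0] with s hs using (hconst s hs).symm)
  have h1 := tendsto_nhds_unique hlim tendsto_thetaRatio_sub_div_thetaQuotient
  exact ((div_eq_one_iff_eq (thetaQuotient_pos hr).ne').1 h1).symm

lemma sqrt_thetaQuotient {r : ℝ} (hr : 0 < r) :
    √(125 + 22 * thetaQuotient r + thetaQuotient r ^ 2) = thetaRatio r + (thetaRatio r)⁻¹ := by
  have hρ := thetaRatio_pos hr
  rw [sqrt_eq_iff_mul_self_eq_of_pos (by positivity), thetaQuotient_eq_thetaRatio_sub hr]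
  field_simp
  ring

lemma hasDerivAt_uF {q : ℝ} (h0 : 0 < q) (h1 : q < 1) :
    HasDerivAt uF (-(eulerF (q ^ 5) ^ 5 / eulerF q) * uF q * √(125 + 22 * uF q + uF q ^ 2)) q := by
  obtain ⟨r, hr, rfl⟩ : ∃ r, 0 < r ∧ exp (-r / 5) = q :=
    ⟨-5 * log q, by nlinarith [log_neg h0 h1], by
      rw [show -(-5 * log q) / 5 = log q by ring, exp_log h0]⟩
  have hlog : -5 * log (exp (-r / 5)) = r := by
    rw [log_exp]
    ring
  have hd := (hasDerivAt_log h0.ne').const_mul (-5)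
  have hQ := hasDerivAt_thetaQuotient hr
  rw [← hlog] at hQ
  have hcomp := hQ.comp (h := fun q ↦ -5 * log q) _ hd
  have heq : uF =ᶠ[nhds (exp (-r / 5))] thetaQuotient ∘ fun q ↦ -5 * log q := by
    filter_upwards [Ioo_mem_nhds h0 h1] with x hx
    have := uF_exp_neg_div_five (r := -5 * log x) (by nlinarith [log_neg hx.1 hx.2])
    rw [show -(-5 * log x) / 5 = log x by ring, exp_log hx.1] at this
    exact this
  refine (hcomp.congr_of_eventuallyEq heq).congr_deriv ?_
  have h5 : exp (-r / 5) ^ 5 = exp (-r) := by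
    rw [← exp_nat_mul]
    ring_nf
  have hf1 := eulerF_pos h0 h1
  have hf5 := expProd_pos hr one_pos
  have he : exp (-r / 8) ^ 2 = exp (-r / 20) * exp (-r / 5) := by
    rw [← exp_nat_mul, ← exp_add]
    ring_nf
  rw [hlog, uF_exp_neg_div_five hr, sqrt_thetaQuotient hr, h5, gaussMoment_fifths hr,
    gaussMoment_one_zero hr, eulerF_exp_neg, mul_pow, he]
  field_simp

theorem uF_deriv :
    (∀ q ∈ Set.Ioo (0 : ℝ) 1,
        HasDerivAt uF
          (-(eulerF (q ^ 5) ^ 5 / eulerF q) * uF q *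
            Real.sqrt (125 + 22 * uF q + uF q ^ 2)) q) ∧
      StrictAntiOn uF (Set.Ioo (0 : ℝ) 1) := by
  have hd (q : ℝ) (hq : q ∈ Set.Ioo (0 : ℝ) 1) := hasDerivAt_uF hq.1 hq.2
  refine ⟨hd, strictAntiOn_of_deriv_neg (convex_Ioo 0 1)
    (fun q hq ↦ (hd q hq).continuousAt.continuousWithinAt) fun q hq ↦ ?_⟩
  rw [interior_Ioo] at hq
  have hf1 := eulerF_pos hq.1 hq.2
  have hf5 := eulerF_pos (pow_pos hq.1 5) (pow_lt_one₀ hq.1.le hq.2 (by norm_num))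
  have hu : 0 < uF q := div_pos (pow_pos hf1 6) (mul_pos hq.1 (pow_pos hf5 6))
  rw [(hd q hq).deriv, neg_mul, neg_mul, neg_lt_zero]
  positivity
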